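/- Let α ∈ ℝ, let r : ℝ/ℤ → ℝ/ℤ be induced by a differentiable function ρ : ℝ → ℝ with ρ(x+1) − ρ(x) ∈ ℤ for all x, suppose r(x + 1/2) = 1 − r(x) (in ℝ/ℤ) for all x, and suppose the skew product homeomorphism F : 𝕋² → 𝕋², F(x,y) = (x + α, y + r(x)), is minimal. Let G : 𝕂 → 𝕂 be the (minimal) homeomorphism of the Klein bottle induced by F. Then there exist a minimal homeomorphism H : 𝕂 → 𝕂, an almost 1-1 factor map π : (𝕂, H) → (𝕂, G), and an arc D ⊆ 𝕂 such that lim_{n→∞} diam H^n(D) = 0. -/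

import Mathlib

open Function Set Topology Filter Metric

/-- A continuous map is minimal if every forward orbit `{f^n x : n ≥ 1}` is dense. -/
def IsMinimalMap {X : Type*} [TopologicalSpace X] (f : X → X) : Prop :=
  Continuous f ∧ ∀ x : X, Dense (Set.range fun n : ℕ => f^[n + 1] x)

/-- A space admits a minimal homeomorphism. -/
def AdmitsMinimalHomeo (X : Type*) [TopologicalSpace X] : Prop :=
  ∃ h : X ≃ₜ X, IsMinimalMap (h : X → X)

/-- Factor map between dynamical systems. -/
def IsFactorMap {X Y : Type*} [TopologicalSpace X] [TopologicalSpace Y]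
    (π : X → Y) (f : X → X) (g : Y → Y) : Prop :=
  Continuous π ∧ Function.Surjective π ∧ π ∘ f = g ∘ π

/-- A map is almost 1-1 if the set of points with singleton fiber is dense. -/
def IsAlmostOneOne {X Y : Type*} [TopologicalSpace X] [TopologicalSpace Y] (π : X → Y) : Prop :=
  Dense {y : Y | ∃! x : X, π x = y}

/-- The 2-torus `(ℝ/ℤ) × (ℝ/ℤ)`. -/
abbrev Torus2 : Type := AddCircle (1 : ℝ) × AddCircle (1 : ℝ)

/-- A subset is an arc if it is homeomorphic to `[0, 1]`. -/
def IsArc {X : Type*} [TopologicalSpace X] (A : Set X) : Prop :=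
  Nonempty (A ≃ₜ Set.Icc (0 : ℝ) 1)

/-- The generating relation for the Klein bottle: `(x, y) ∼ (x + 1/2, 1 - y)`. -/
def kleinRel : Torus2 → Torus2 → Prop :=
  fun a b => b = (a.1 + (((1 : ℝ) / 2 : ℝ) : AddCircle (1 : ℝ)),
    (((1 : ℝ) : AddCircle (1 : ℝ))) - a.2)

/-- The half-turn reflection `(x, y) ↦ (x + 1/2, 1 - y)` whose orbits are the points of the Klein
bottle. -/
noncomputable def kleinInvolution (q : Torus2) : Torus2 :=
  (q.1 + (((1 : ℝ) / 2 : ℝ) : AddCircle (1 : ℝ)), (((1 : ℝ) : AddCircle (1 : ℝ))) - q.2)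

/-- An odd triangle wave on the circle, equal to the identity on `[-1/4, 1/4]`. -/
noncomputable def triangleWave (t : AddCircle (1 : ℝ)) : ℝ :=
  (‖t + (((1 : ℝ) / 4 : ℝ) : AddCircle (1 : ℝ))‖ - ‖t - (((1 : ℝ) / 4 : ℝ) : AddCircle (1 : ℝ))‖) / 2

/-- A contraction factor equal to `1` exactly when `2 • x = 0`. -/
noncomputable def foldFactor (x : AddCircle (1 : ℝ)) : ℝ := 1 - ‖(2 : ℕ) • x‖

/-- The vertical displacement of the collapsing map. -/
noncomputable def foldHeight (q : Torus2) : ℝ := foldFactor q.1 * triangleWave q.2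

/-- The vertical map of the torus collapsing the arcs `{0} × [-1/4, 1/4]` and
`{1/2} × [-1/4, 1/4]` to points and injective elsewhere. -/
noncomputable def collapse (q : Torus2) : Torus2 :=
  (q.1, q.2 - (foldHeight q : AddCircle (1 : ℝ)))

theorem continuous_triangleWave : Continuous triangleWave := by
  unfold triangleWave; fun_prop

theorem continuous_foldFactor : Continuous foldFactor := by
  unfold foldFactor; fun_prop

theorem continuous_foldHeight : Continuous foldHeight :=
  (continuous_foldFactor.comp continuous_fst).mul (continuous_triangleWave.comp continuous_snd)

theorem continuous_coe_circle : Continuous fun s : ℝ => (s : AddCircle (1 : ℝ)) :=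
  AddCircle.continuous_mk' 1

theorem continuous_collapse : Continuous collapse :=
  continuous_fst.prodMk (continuous_snd.sub (continuous_coe_circle.comp continuous_foldHeight))

theorem circle_norm_le_half (x : AddCircle (1 : ℝ)) : ‖x‖ ≤ 1 / 2 := by
  simpa using AddCircle.norm_le_half_period (1 : ℝ) (x := x) one_ne_zero

theorem circle_norm_coe_le (x : ℝ) (n : ℤ) : ‖(x : AddCircle (1 : ℝ))‖ ≤ |x - n| := by
  rw [UnitAddCircle.norm_eq]; exact round_le x n

theorem circle_norm_coe_le_abs (x : ℝ) : ‖(x : AddCircle (1 : ℝ))‖ ≤ |x| := by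
  simpa using circle_norm_coe_le x 0

theorem circle_coe_eq_zero {x : ℝ} : (x : AddCircle (1 : ℝ)) = 0 ↔ ∃ n : ℤ, (n : ℝ) = x := by
  rw [AddCircle.coe_eq_zero_iff]; simp

theorem circle_coe_one : ((1 : ℝ) : AddCircle (1 : ℝ)) = 0 := AddCircle.coe_period 1

theorem circle_two_nsmul_half : (2 : ℕ) • (((1 : ℝ) / 2 : ℝ) : AddCircle (1 : ℝ)) = 0 := by
  rw [← AddCircle.coe_nsmul, ← circle_coe_one]; norm_num

theorem circle_half_ne_zero : (((1 : ℝ) / 2 : ℝ) : AddCircle (1 : ℝ)) ≠ 0 := by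
  rw [Ne, circle_coe_eq_zero]
  rintro ⟨n, hn⟩
  have h : ((2 * n : ℤ) : ℝ) = ((1 : ℤ) : ℝ) := by push_cast; linarith
  have := Int.cast_injective h
  omega

theorem foldFactor_nonneg (x : AddCircle (1 : ℝ)) : 0 ≤ foldFactor x := by
  have := circle_norm_le_half ((2 : ℕ) • x)
  unfold foldFactor; linarith

theorem foldFactor_le_one (x : AddCircle (1 : ℝ)) : foldFactor x ≤ 1 := by
  have := norm_nonneg ((2 : ℕ) • x)
  unfold foldFactor; linarith

theorem foldFactor_lt_one {x : AddCircle (1 : ℝ)} (hx : (2 : ℕ) • x ≠ 0) : foldFactor x < 1 := by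
  have := norm_pos_iff.2 hx
  unfold foldFactor; linarith

theorem abs_triangleWave_sub_le (t t' : AddCircle (1 : ℝ)) :
    |triangleWave t' - triangleWave t| ≤ ‖t' - t‖ := by
  unfold triangleWave
  set c := (((1 : ℝ) / 4 : ℝ) : AddCircle (1 : ℝ))
  have h1 := abs_norm_sub_norm_le (t' + c) (t + c)
  have h2 := abs_norm_sub_norm_le (t' - c) (t - c)
  rw [add_sub_add_right_eq_sub] at h1
  rw [sub_sub_sub_cancel_right] at h2
  rw [abs_le] at *
  constructor <;> linarith [h1.1, h1.2, h2.1, h2.2]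

theorem abs_triangleWave_le (t : AddCircle (1 : ℝ)) : |triangleWave t| ≤ 1 / 4 := by
  unfold triangleWave
  set c := (((1 : ℝ) / 4 : ℝ) : AddCircle (1 : ℝ))
  have h1 := circle_norm_le_half (t + c)
  have h2 := circle_norm_le_half (t - c)
  have h3 := norm_nonneg (t + c)
  have h4 := norm_nonneg (t - c)
  rw [abs_le]
  constructor <;> linarith

theorem triangleWave_neg (t : AddCircle (1 : ℝ)) : triangleWave (-t) = -triangleWave t := by
  unfold triangleWave
  set c := (((1 : ℝ) / 4 : ℝ) : AddCircle (1 : ℝ))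
  have h1 : -t + c = -(t - c) := by abel
  have h2 : -t - c = -(t + c) := by abel
  rw [h1, h2, norm_neg, norm_neg]; ring

theorem triangleWave_coe {t : ℝ} (ht : |t| ≤ 1 / 4) :
    triangleWave (t : AddCircle (1 : ℝ)) = t := by
  obtain ⟨h1, h2⟩ := abs_le.1 ht
  unfold triangleWave
  rw [← AddCircle.coe_add, ← AddCircle.coe_sub,
    (AddCircle.norm_coe_eq_abs_iff (1 : ℝ) one_ne_zero).2,
    (AddCircle.norm_coe_eq_abs_iff (1 : ℝ) one_ne_zero).2, abs_of_nonneg, abs_of_nonpos]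
  · ring
  all_goals first | linarith | (rw [abs_le]; norm_num; constructor <;> linarith)

theorem abs_foldHeight_le (q : Torus2) : |foldHeight q| ≤ 1 / 4 := by
  unfold foldHeight
  rw [abs_mul, abs_of_nonneg (foldFactor_nonneg _)]
  have h1 := foldFactor_le_one q.1
  have h2 := abs_triangleWave_le q.2
  have h3 := abs_nonneg (triangleWave q.2)
  nlinarith [foldFactor_nonneg q.1]

theorem abs_foldHeight_sub_le {q q' : Torus2} (h : q'.1 = q.1) :
    |foldHeight q' - foldHeight q| ≤ foldFactor q.1 * ‖q'.2 - q.2‖ := by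
  unfold foldHeight
  rw [h, ← mul_sub, abs_mul, abs_of_nonneg (foldFactor_nonneg _)]
  exact mul_le_mul_of_nonneg_left (abs_triangleWave_sub_le _ _) (foldFactor_nonneg _)

theorem foldHeight_kleinInvolution (q : Torus2) :
    foldHeight (kleinInvolution q) = -foldHeight q := by
  unfold foldHeight kleinInvolution foldFactor
  simp only [nsmul_add, circle_two_nsmul_half, add_zero, circle_coe_one, zero_sub,
    triangleWave_neg, mul_neg]

theorem kleinInvolution_add_vertical (q : Torus2) (c : AddCircle (1 : ℝ)) :
    kleinInvolution (q.1, q.2 + c) = ((kleinInvolution q).1, (kleinInvolution q).2 - c) := by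
  simp only [kleinInvolution, Prod.mk.injEq, true_and]; abel

theorem kleinInvolution_involutive : Function.Involutive kleinInvolution := by
  rintro ⟨x, y⟩
  have h := circle_two_nsmul_half
  rw [two_nsmul] at h
  simp [kleinInvolution, add_assoc, -one_div, h]

theorem collapse_kleinInvolution (q : Torus2) :
    collapse (kleinInvolution q) = kleinInvolution (collapse q) := by
  have h := kleinInvolution_add_vertical q (-(foldHeight q : AddCircle (1 : ℝ)))
  rw [← sub_eq_add_neg] at h
  unfold collapse
  rw [h, foldHeight_kleinInvolution, AddCircle.coe_neg]

/-- Points of one vertical circle whose images under `collapse` differ by `d` have fold heights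
which differ by at least `-d` and at most `1 - d`. -/
theorem foldHeight_sub_mem {q q' : Torus2} (h : q'.1 = q.1) {d : ℝ} (hd0 : 0 < d) (hd1 : d < 1)
    (hc : (collapse q').2 = (collapse q).2 + (d : AddCircle (1 : ℝ))) :
    -d ≤ foldHeight q' - foldHeight q ∧ foldHeight q' - foldHeight q ≤ 1 - d := by
  set δ := foldHeight q' - foldHeight q with hδ
  have h1 : q'.2 - q.2 = ((d + δ : ℝ) : AddCircle (1 : ℝ)) := by
    simp only [collapse] at hc
    rw [sub_eq_iff_eq_add] at hc
    rw [hδ, AddCircle.coe_add, AddCircle.coe_sub, hc]; abel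
  have h2 : |δ| ≤ ‖q'.2 - q.2‖ :=
    (abs_foldHeight_sub_le h).trans
      (mul_le_of_le_one_left (norm_nonneg _) (foldFactor_le_one _))
  rw [h1] at h2
  have h3 := h2.trans (circle_norm_coe_le_abs _)
  have h4 := h2.trans (circle_norm_coe_le _ 1)
  push_cast at h4
  constructor
  · by_contra! hlt
    rw [abs_of_neg (by linarith), abs_of_neg (by linarith)] at h3
    linarith
  · by_contra! hlt
    rw [abs_of_pos (by linarith), abs_of_pos (by linarith)] at h4
    linarith

/-- Away from `2 • x = 0`, fold heights depend in a Lipschitz way on the image under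
`collapse`. -/
theorem abs_foldHeight_sub_le_collapse {q q' : Torus2} (h : q'.1 = q.1) :
    (1 - foldFactor q.1) * |foldHeight q' - foldHeight q| ≤
      ‖(collapse q').2 - (collapse q).2‖ := by
  set δ := foldHeight q' - foldHeight q with hδ
  have h1 : q'.2 - q.2 =
      ((collapse q').2 - (collapse q).2) + ((δ : ℝ) : AddCircle (1 : ℝ)) := by
    simp only [collapse]
    rw [hδ, AddCircle.coe_sub]; abel
  have h2 : |δ| ≤ foldFactor q.1 * ‖q'.2 - q.2‖ := abs_foldHeight_sub_le h
  have h3 : ‖q'.2 - q.2‖ ≤ ‖(collapse q').2 - (collapse q).2‖ + |δ| := by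
    rw [h1]
    exact (norm_add_le _ _).trans (by gcongr; exact circle_norm_coe_le_abs _)
  have h4 := mul_le_mul_of_nonneg_left h3 (foldFactor_nonneg q.1)
  have h5 := mul_le_of_le_one_left (norm_nonneg ((collapse q').2 - (collapse q).2))
    (foldFactor_le_one q.1)
  linarith

theorem eq_of_collapse_eq_of_foldHeight_eq {q q' : Torus2} (h : collapse q = collapse q')
    (hh : foldHeight q = foldHeight q') : q = q' := by
  simp only [collapse, Prod.mk.injEq, hh, sub_left_inj] at h
  exact Prod.ext h.1 h.2

theorem collapse_injOn {q q' : Torus2} (hq : (2 : ℕ) • q.1 ≠ 0)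
    (h : collapse q = collapse q') : q = q' := by
  refine eq_of_collapse_eq_of_foldHeight_eq h ?_
  have h1 : q'.1 = q.1 := (congrArg Prod.fst h).symm
  have h2 := abs_foldHeight_sub_le_collapse h1
  rw [h, sub_self, norm_zero] at h2
  have h3 : |foldHeight q' - foldHeight q| ≤ 0 :=
    nonpos_of_mul_nonpos_right h2 (sub_pos.2 (foldFactor_lt_one hq))
  exact (sub_eq_zero.1 (abs_nonpos_iff.1 h3)).symm

theorem surjective_add_of_bounded {β : ℝ → ℝ} (hβ : Continuous β) {B : ℝ}
    (hB : ∀ x, |β x| ≤ B) : Function.Surjective fun x => x + β x := by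
  refine Continuous.surjective (by fun_prop) ?_ ?_
  · exact tendsto_atTop_add_right_of_le _ (-B) tendsto_id fun x => (abs_le.1 (hB x)).1
  · exact tendsto_atBot_add_right_of_ge _ B tendsto_id fun x => (abs_le.1 (hB x)).2

theorem collapse_surjective : Function.Surjective collapse := by
  rintro ⟨x, y⟩
  obtain ⟨y, rfl⟩ := QuotientAddGroup.mk_surjective y
  obtain ⟨t, ht⟩ := surjective_add_of_bounded
    (β := fun t : ℝ => -foldHeight (x, (t : AddCircle (1 : ℝ)))) (B := 1 / 4)
    ((continuous_foldHeight.comp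
      (continuous_const.prodMk continuous_coe_circle)).neg)
    (fun t => by rw [abs_neg]; exact abs_foldHeight_le _) y
  refine ⟨(x, (t : AddCircle (1 : ℝ))), ?_⟩
  simp only [collapse, Prod.mk.injEq, true_and]
  rw [← AddCircle.coe_sub, sub_eq_add_neg]
  exact congrArg _ ht

theorem collapse_coe {t : ℝ} (ht : |t| ≤ 1 / 4) :
    collapse (0, (t : AddCircle (1 : ℝ))) = (0, 0) := by
  simp [collapse, foldHeight, foldFactor, triangleWave_coe ht]

/-- The bi-infinite sequences whose images under `collapse` form a full orbit of `F`. -/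
def orbitLifts (F : Torus2 → Torus2) : Set (ℤ → Torus2) :=
  {z | ∀ n, collapse (z (n + 1)) = F (collapse (z n))}

/-- The point of the torus obtained from `collapse (z 0)` by moving vertically by the weighted sum
of the fold heights of `z`. -/
noncomputable def orbitPoint (w : ℤ → ℝ) (z : ℤ → Torus2) : Torus2 :=
  ((z 0).1, (collapse (z 0)).2 + ((∑' n, w n * foldHeight (z n) : ℝ) : AddCircle (1 : ℝ)))

theorem isClosed_orbitLifts {F : Torus2 → Torus2} (hF : Continuous F) :
    IsClosed (orbitLifts F) := by
  simp only [orbitLifts, ofPred_forall]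
  refine isClosed_iInter fun n => isClosed_eq ?_ ?_
  · exact continuous_collapse.comp (continuous_apply _)
  · exact hF.comp (continuous_collapse.comp (continuous_apply _))

theorem norm_mul_foldHeight_le {w : ℤ → ℝ} (hw : ∀ n, 0 < w n) (n : ℤ) (q : Torus2) :
    ‖w n * foldHeight q‖ ≤ w n := by
  rw [norm_mul, Real.norm_of_nonneg (hw n).le, Real.norm_eq_abs]
  exact mul_le_of_le_one_right (hw n).le ((abs_foldHeight_le q).trans (by norm_num))

theorem summable_mul_foldHeight {w : ℤ → ℝ} (hw : ∀ n, 0 < w n) (hs : Summable w)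
    (z : ℤ → Torus2) : Summable fun n => w n * foldHeight (z n) :=
  hs.of_norm_bounded fun n => norm_mul_foldHeight_le hw n (z n)

theorem continuous_orbitPoint {w : ℤ → ℝ} (hw : ∀ n, 0 < w n) (hs : Summable w) :
    Continuous (orbitPoint w) := by
  refine (continuous_fst.comp (continuous_apply 0)).prodMk
    ((continuous_snd.comp (continuous_collapse.comp (continuous_apply 0))).add
      (continuous_coe_circle.comp ?_))
  exact continuous_tsum
    (fun n => continuous_const.mul (continuous_foldHeight.comp (continuous_apply n))) hs
    fun n z => norm_mul_foldHeight_le hw n (z n)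

theorem orbitPoint_kleinInvolution (w : ℤ → ℝ) (z : ℤ → Torus2) :
    orbitPoint w (fun n => kleinInvolution (z n)) = kleinInvolution (orbitPoint w z) := by
  have h := kleinInvolution_add_vertical (collapse (z 0))
    ((∑' n, w n * foldHeight (z n) : ℝ) : AddCircle (1 : ℝ))
  have h2 : orbitPoint w z = ((collapse (z 0)).1, (collapse (z 0)).2 +
    ((∑' n, w n * foldHeight (z n) : ℝ) : AddCircle (1 : ℝ))) := rfl
  rw [h2, h, ← collapse_kleinInvolution]
  simp only [orbitPoint, foldHeight_kleinInvolution, mul_neg, tsum_neg, AddCircle.coe_neg,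
    collapse, sub_eq_add_neg]

theorem exists_orbitLift (F : Torus2 ≃ₜ Torus2) (q : Torus2) :
    ∃ z ∈ orbitLifts F, ∀ n : ℤ, collapse (z n) = (F ^ n : Torus2 ≃ₜ Torus2) q := by
  choose z hz using fun n : ℤ => collapse_surjective ((F ^ n : Torus2 ≃ₜ Torus2) q)
  refine ⟨z, fun n => ?_, hz⟩
  rw [hz, hz, add_comm, zpow_add, zpow_one]; rfl

section SkewProduct

variable {F : Torus2 ≃ₜ Torus2} {a : AddCircle (1 : ℝ)} {r : AddCircle (1 : ℝ) → AddCircle (1 : ℝ)}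

theorem skew_add_vertical (hF : ∀ q, F q = (q.1 + a, q.2 + r q.1)) (q : Torus2)
    (c : AddCircle (1 : ℝ)) : F (q + (0, c)) = F q + (0, c) := by
  rw [hF, hF]
  ext
  · simp
  · simp; abel

theorem fst_orbitLift (hF : ∀ q, F q = (q.1 + a, q.2 + r q.1)) {z : ℤ → Torus2}
    (hz : z ∈ orbitLifts F) (n : ℤ) : (z n).1 = (z 0).1 + n • a := by
  have hstep : ∀ n : ℤ, (z (n + 1)).1 = (z n).1 + a := fun n => by
    have := congrArg Prod.fst (hz n)
    rwa [hF] at this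
  induction n using Int.induction_on with
  | zero => simp
  | succ i ih => rw [hstep, ih, add_smul, one_smul, add_assoc]
  | pred i ih =>
    have := hstep (-(i : ℤ) - 1)
    rw [sub_add_cancel, ih] at this
    rw [sub_smul, one_smul, ← add_sub_assoc, this, add_sub_cancel_right]

theorem collapse_orbitLift_add (hF : ∀ q, F q = (q.1 + a, q.2 + r q.1)) {z z' : ℤ → Torus2}
    (hz : z ∈ orbitLifts F) (hz' : z' ∈ orbitLifts F) {c : AddCircle (1 : ℝ)}
    (h : collapse (z' 0) = collapse (z 0) + (0, c)) (n : ℤ) :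
    collapse (z' n) = collapse (z n) + (0, c) := by
  induction n using Int.induction_on with
  | zero => exact h
  | succ i ih => rw [hz, hz', ih, skew_add_vertical hF]
  | pred i ih =>
    apply F.injective
    rw [skew_add_vertical hF, ← hz, ← hz', sub_add_cancel, ih]

/-- At most one coordinate of an orbit lies over the vertical circles `2 • x = 0`. -/
theorem orbitLift_singular_unique (hF : ∀ q, F q = (q.1 + a, q.2 + r q.1))
    (ha : ∀ n : ℤ, n ≠ 0 → n • ((2 : ℕ) • a) ≠ 0) {z : ℤ → Torus2} (hz : z ∈ orbitLifts F)
    {m n : ℤ} (hm : (2 : ℕ) • (z m).1 = 0) (hn : (2 : ℕ) • (z n).1 = 0) : m = n := by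
  by_contra hne
  refine ha (m - n) (sub_ne_zero.2 hne) ?_
  have h : (2 : ℕ) • (z m).1 - (2 : ℕ) • (z n).1 = 0 := by rw [hm, hn, sub_zero]
  rw [fst_orbitLift hF hz m, fst_orbitLift hF hz n, ← nsmul_sub, add_sub_add_left_eq_sub,
    ← sub_smul, smul_comm] at h
  exact h

theorem injOn_orbitPoint (hF : ∀ q, F q = (q.1 + a, q.2 + r q.1))
    (ha : ∀ n : ℤ, n ≠ 0 → n • ((2 : ℕ) • a) ≠ 0) {w : ℤ → ℝ} (hw : ∀ n, 0 < w n)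
    (hs : Summable w) (hw1 : ∑' n, w n ≤ 1 / 2) : InjOn (orbitPoint w) (orbitLifts F) := by
  intro z hz z' hz' h
  have hfst0 : (z' 0).1 = (z 0).1 := (congrArg Prod.fst h).symm
  have hfst : ∀ n, (z' n).1 = (z n).1 := fun n => by
    rw [fst_orbitLift hF hz, fst_orbitLift hF hz', hfst0]
  have hsnd := congrArg Prod.snd h
  simp only [orbitPoint] at hsnd
  obtain ⟨d, ⟨hd0, hd1⟩, hd⟩ : ∃ d ∈ Ico (0 : ℝ) 1,
      (d : AddCircle (1 : ℝ)) = (collapse (z' 0)).2 - (collapse (z 0)).2 := by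
    have := AddCircle.coe_image_Ico_eq (1 : ℝ) 0
    have h1 : (collapse (z' 0)).2 - (collapse (z 0)).2 ∈
      ((↑) : ℝ → AddCircle (1 : ℝ)) '' Ico 0 (0 + 1) := by rw [this]; trivial
    rwa [zero_add] at h1
  have hcol : ∀ n, collapse (z' n) = collapse (z n) + (0, (d : AddCircle (1 : ℝ))) := by
    refine collapse_orbitLift_add hF hz hz' (Prod.ext ?_ ?_)
    · simpa [collapse] using hfst0
    · simp [hd]
  have hS := summable_mul_foldHeight hw hs z
  have hS' := summable_mul_foldHeight hw hs z'
  set δ : ℤ → ℝ := fun n => foldHeight (z' n) - foldHeight (z n) with hδ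
  have hSδ : Summable fun n => w n * δ n := by
    simpa only [hδ, mul_sub] using hS'.sub hS
  have htδ : ∑' n, w n * δ n = ∑' n, w n * foldHeight (z' n) - ∑' n, w n * foldHeight (z n) := by
    simp only [hδ, mul_sub]; exact hS'.tsum_sub hS
  obtain ⟨k, hk⟩ : ∃ k : ℤ, (k : ℝ) = d + ∑' n, w n * δ n := by
    rw [← circle_coe_eq_zero, AddCircle.coe_add, hd, htδ, AddCircle.coe_sub,
      sub_add_sub_comm, ← hsnd, sub_self]
  have hk0 : ∀ s : ℝ, s = k → -1 < s → s < 1 → s = 0 := by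
    rintro s rfl h1 h2
    have h3 : -1 < k := by exact_mod_cast h1
    have h4 : k < 1 := by exact_mod_cast h2
    have : k = 0 := by omega
    simp [this]
  have hdz : d = 0 := by
    by_contra hne
    have hpos : 0 < d := lt_of_le_of_ne hd0 (Ne.symm hne)
    have hb := fun n => foldHeight_sub_mem (hfst n) hpos hd1 (congrArg Prod.snd (hcol n))
    have hlo : (∑' n, w n) * (-d) ≤ ∑' n, w n * δ n := by
      rw [← tsum_mul_right]
      exact (hs.mul_right _).tsum_le_tsum
        (fun n => mul_le_mul_of_nonneg_left (hb n).1 (hw n).le) hSδ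
    have hhi : ∑' n, w n * δ n ≤ (∑' n, w n) * (1 - d) := by
      rw [← tsum_mul_right]
      exact hSδ.tsum_le_tsum
        (fun n => mul_le_mul_of_nonneg_left (hb n).2 (hw n).le) (hs.mul_right _)
    have h0 := hk0 _ hk.symm (by nlinarith) (by nlinarith)
    nlinarith
  have hcol' : ∀ n, collapse (z n) = collapse (z' n) := fun n => by
    rw [hcol n, hdz]; simp
  have hreg : ∀ n, (2 : ℕ) • (z n).1 ≠ 0 → z n = z' n := fun n hn => collapse_injOn hn (hcol' n)
  funext m
  by_cases hm : (2 : ℕ) • (z m).1 = 0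
  · have hδ0 : ∀ n, n ≠ m → w n * δ n = 0 := fun n hn => by
      have : z n = z' n := hreg n fun h0 => hn (orbitLift_singular_unique hF ha hz h0 hm)
      simp [hδ, this]
    rw [tsum_eq_single m hδ0, hdz, zero_add] at hk
    have hwm : w m ≤ 1 / 2 := (hs.le_tsum m fun n _ => (hw n).le).trans hw1
    have hb1 := abs_le.1 (abs_foldHeight_le (z m))
    have hb2 := abs_le.1 (abs_foldHeight_le (z' m))
    have hwp := hw m
    have h0 := hk0 _ hk.symm (by simp only [hδ]; nlinarith) (by simp only [hδ]; nlinarith)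
    have h1 : δ m = 0 := (mul_eq_zero.1 h0).resolve_left hwp.ne'
    exact eq_of_collapse_eq_of_foldHeight_eq (hcol' m) (sub_eq_zero.1 h1).symm
  · exact hreg m hm

theorem fst_zpow_skew (hF : ∀ q, F q = (q.1 + a, q.2 + r q.1)) (q : Torus2) (n : ℤ) :
    ((F ^ n : Torus2 ≃ₜ Torus2) q).1 = q.1 + n • a := by
  obtain ⟨z, hz, hzn⟩ := exists_orbitLift F q
  have h := fst_orbitLift hF hz n
  have hq := hzn 0
  rw [zpow_zero] at hq
  have h0 : (collapse (z 0)).1 = q.1 := by rw [hq]; rfl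
  rw [← hzn n, ← h0]; exact h

/-- Every vertical circle missing the singular circles is covered by `orbitPoint`. -/
theorem exists_orbitPoint_eq_of_regular (hF : ∀ q, F q = (q.1 + a, q.2 + r q.1))
    {w : ℤ → ℝ} (hw : ∀ n, 0 < w n) (hs : Summable w) {q : Torus2}
    (hq : ∀ n : ℤ, (2 : ℕ) • (q.1 + n • a) ≠ 0) : ∃ z ∈ orbitLifts F, orbitPoint w z = q := by
  obtain ⟨x, y⟩ := q
  obtain ⟨y, rfl⟩ := QuotientAddGroup.mk_surjective y
  choose z hz hzn using fun u : ℝ => exists_orbitLift F (x, (u : AddCircle (1 : ℝ)))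
  have hfst : ∀ u n, (z u n).1 = x + n • a := fun u n => by
    rw [← fst_zpow_skew hF (x, (u : AddCircle (1 : ℝ))) n, ← hzn]; rfl
  have hcont : ∀ n, Continuous fun u => foldHeight (z u n) := by
    intro n
    rw [continuous_iff_continuousAt]
    intro u₀
    have hpos : 0 < 1 - foldFactor (x + n • a) := sub_pos.2 (foldFactor_lt_one (hq n))
    have hg : Continuous fun u : ℝ =>
        ((F ^ n : Torus2 ≃ₜ Torus2) (x, (u : AddCircle (1 : ℝ)))).2 :=
      continuous_snd.comp ((F ^ n : Torus2 ≃ₜ Torus2).continuous.comp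
        (continuous_const.prodMk continuous_coe_circle))
    have hlim : Tendsto (fun u : ℝ => (1 - foldFactor (x + n • a))⁻¹ *
        ‖((F ^ n : Torus2 ≃ₜ Torus2) (x, (u : AddCircle (1 : ℝ)))).2 -
          ((F ^ n : Torus2 ≃ₜ Torus2) (x, (u₀ : AddCircle (1 : ℝ)))).2‖) (𝓝 u₀) (𝓝 0) := by
      have : Continuous (fun u : ℝ => (1 - foldFactor (x + n • a))⁻¹ *
        ‖((F ^ n : Torus2 ≃ₜ Torus2) (x, (u : AddCircle (1 : ℝ)))).2 -
          ((F ^ n : Torus2 ≃ₜ Torus2) (x, (u₀ : AddCircle (1 : ℝ)))).2‖) := by fun_prop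
      simpa using this.tendsto u₀
    refine tendsto_iff_dist_tendsto_zero.2 (squeeze_zero (fun _ => dist_nonneg) (fun u => ?_) hlim)
    have h := abs_foldHeight_sub_le_collapse ((hfst u n).trans (hfst u₀ n).symm)
    rw [hfst u₀ n, hzn, hzn] at h
    rw [Real.dist_eq, inv_mul_eq_div, le_div_iff₀' hpos]
    exact h
  obtain ⟨u, hu⟩ := surjective_add_of_bounded
    (β := fun u : ℝ => ∑' n, w n * foldHeight (z u n)) (B := ∑' n, w n)
    (continuous_tsum (fun n => continuous_const.mul (hcont n)) hs
      fun n u => norm_mul_foldHeight_le hw n (z u n))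
    (fun u => tsum_of_norm_bounded hs.hasSum fun n => norm_mul_foldHeight_le hw n (z u n)) y
  refine ⟨z u, hz u, Prod.ext ?_ ?_⟩
  · simpa [orbitPoint] using hfst u 0
  · have h0 : (collapse (z u 0)).2 = (u : AddCircle (1 : ℝ)) := congrArg Prod.snd (hzn u 0)
    simp only [orbitPoint, h0]
    rw [← AddCircle.coe_add]
    exact congrArg _ hu

/-- The vertical circles missing the singular circles are dense. -/
theorem dense_regular (a : AddCircle (1 : ℝ)) :
    Dense {q : Torus2 | ∀ n : ℤ, (2 : ℕ) • (q.1 + n • a) ≠ 0} := by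
  obtain ⟨α, rfl⟩ := QuotientAddGroup.mk_surjective a
  have hcount : (range fun m : ℤ × ℤ => (m.1 : ℝ) / 2 - m.2 * α).Countable := countable_range _
  have hd := (QuotientAddGroup.mk_surjective
    (s := AddSubgroup.zmultiples (1 : ℝ))).denseRange.dense_image
    continuous_coe_circle (hcount.dense_compl ℝ)
  have : Dense ({x : AddCircle (1 : ℝ) |
      ∀ n : ℤ, (2 : ℕ) • (x + n • (α : AddCircle (1 : ℝ))) ≠ 0}) := by
    refine hd.mono ?_
    rintro _ ⟨x, hx, rfl⟩ n h
    have h1 : ((2 * (x + n * α) : ℝ) : AddCircle (1 : ℝ)) = 0 := by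
      rw [← h]
      change _ = (2 : ℕ) • ((x : AddCircle (1 : ℝ)) + n • (α : AddCircle (1 : ℝ)))
      rw [← AddCircle.coe_zsmul, ← AddCircle.coe_add, ← AddCircle.coe_nsmul,
        zsmul_eq_mul, nsmul_eq_mul, Nat.cast_ofNat]
    obtain ⟨k, hk⟩ := circle_coe_eq_zero.1 h1
    exact hx ⟨(k, n), by simp only; linarith⟩
  exact this.preimage isOpenMap_fst

theorem surjOn_orbitPoint (hF : ∀ q, F q = (q.1 + a, q.2 + r q.1))
    {w : ℤ → ℝ} (hw : ∀ n, 0 < w n) (hs : Summable w) :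
    SurjOn (orbitPoint w) (orbitLifts F) univ := by
  have hcl : IsClosed (orbitPoint w '' orbitLifts F) :=
    ((isClosed_orbitLifts F.continuous).isCompact.image (continuous_orbitPoint hw hs)).isClosed
  rw [SurjOn, ← (dense_regular a).closure_eq]
  refine closure_minimal (fun q hq => ?_) hcl
  obtain ⟨z, hz, h⟩ := exists_orbitPoint_eq_of_regular hF hw hs hq
  exact ⟨z, hz, h⟩

end SkewProduct

theorem dist_orbitPoint_le {w : ℤ → ℝ} (hw : ∀ n, 0 < w n) (hs : Summable w)
    {z z' : ℤ → Torus2} {m : ℤ} (hne : ∀ n, n ≠ m → z n = z' n)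
    (hcol : ∀ n, collapse (z n) = collapse (z' n)) :
    dist (orbitPoint w z) (orbitPoint w z') ≤ w m := by
  have hsub : ∑' n, w n * foldHeight (z n) - ∑' n, w n * foldHeight (z' n) =
      w m * (foldHeight (z m) - foldHeight (z' m)) := by
    rw [← (summable_mul_foldHeight hw hs z).tsum_sub (summable_mul_foldHeight hw hs z'),
      tsum_eq_single m fun n hn => by rw [hne n hn, sub_self], mul_sub]
  have hcol0 : (collapse (z 0)).1 = (collapse (z' 0)).1 := congrArg Prod.fst (hcol 0)
  have hfst : (orbitPoint w z).1 = (orbitPoint w z').1 := hcol0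
  rw [Prod.dist_eq, hfst, dist_self, max_eq_right dist_nonneg]
  simp only [orbitPoint, hcol 0, dist_add_left]
  rw [dist_eq_norm, ← AddCircle.coe_sub, hsub]
  refine (circle_norm_coe_le_abs _).trans ?_
  have h1 := abs_le.1 (abs_foldHeight_le (z m))
  have h2 := abs_le.1 (abs_foldHeight_le (z' m))
  rw [abs_mul, abs_of_pos (hw m)]
  refine mul_le_of_le_one_right (hw m).le (abs_le.2 ?_)
  constructor <;> linarith

/-- The shift on the space of orbit lifts. -/
def orbitLiftsShift (F : Torus2 → Torus2) : orbitLifts F ≃ₜ orbitLifts F where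
  toFun z := ⟨fun n => z.1 (n + 1), fun n => z.2 (n + 1)⟩
  invFun z := ⟨fun n => z.1 (n - 1), fun n => by
    simpa only [sub_add_cancel, add_sub_cancel_right] using z.2 (n - 1)⟩
  left_inv z := Subtype.ext (funext fun n => by simp)
  right_inv z := Subtype.ext (funext fun n => by simp)
  continuous_toFun := by
    refine Continuous.subtype_mk (continuous_pi fun n => ?_) _
    exact (continuous_apply (n + 1)).comp continuous_subtype_val
  continuous_invFun := by
    refine Continuous.subtype_mk (continuous_pi fun n => ?_) _
    exact (continuous_apply (n - 1)).comp continuous_subtype_val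

theorem orbitLiftsShift_iterate_apply (F : Torus2 → Torus2) (z : orbitLifts F) (n : ℕ) (k : ℤ) :
    ((orbitLiftsShift F)^[n] z).1 k = z.1 (k + n) := by
  induction n generalizing k with
  | zero => simp
  | succ n ih =>
    rw [Function.iterate_succ_apply']
    change ((orbitLiftsShift F)^[n] z).1 (k + 1) = _
    rw [ih, Nat.cast_succ, add_assoc, add_comm 1 (n : ℤ)]

/-- An equivariant extension of a skew product of the torus by a homeomorphism of the torus, with
an arc in the fibre over `(0, 0)` which is contracted by the iterates. -/
theorem exists_torus_extension {F : Torus2 ≃ₜ Torus2} {a : AddCircle (1 : ℝ)}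
    {r : AddCircle (1 : ℝ) → AddCircle (1 : ℝ)} (hF : ∀ q, F q = (q.1 + a, q.2 + r q.1))
    (ha : ∀ n : ℤ, n ≠ 0 → n • ((2 : ℕ) • a) ≠ 0)
    (hsym : ∀ q, F (kleinInvolution q) = kleinInvolution (F q)) :
    ∃ (Φ : Torus2 ≃ₜ Torus2) (P : Torus2 → Torus2) (γ : Icc (0 : ℝ) 1 → Torus2) (ε : ℕ → ℝ),
      (∀ q, Φ (kleinInvolution q) = kleinInvolution (Φ q)) ∧
      Continuous P ∧ Function.Surjective P ∧ (∀ q, P (Φ q) = F (P q)) ∧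
      (∀ q, P (kleinInvolution q) = kleinInvolution (P q)) ∧
      (∀ q, (P q).1 = q.1) ∧
      (∀ q q', (∀ n : ℤ, (2 : ℕ) • (q.1 + n • a) ≠ 0) → P q = P q' → q = q') ∧
      Continuous γ ∧ Function.Injective γ ∧ (∀ t, (γ t).1 = 0) ∧
      Tendsto ε atTop (𝓝 0) ∧ ∀ n t t', dist (Φ^[n] (γ t)) (Φ^[n] (γ t')) ≤ ε n := by
  obtain ⟨w, hw, c, hc, hc1⟩ := posSumOfEncodable (ε := 1 / 2) (by norm_num) ℤ
  have hs := hc.summable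
  have hw1 : ∑' n, w n ≤ 1 / 2 := hc.tsum_eq.trans_le hc1
  have : CompactSpace (orbitLifts F) :=
    isCompact_iff_compactSpace.1 (isClosed_orbitLifts F.continuous).isCompact
  have hcont : Continuous fun z : orbitLifts F => orbitPoint w z.1 :=
    (continuous_orbitPoint hw hs).comp continuous_subtype_val
  have hbij : Function.Bijective fun z : orbitLifts F => orbitPoint w z.1 := by
    refine ⟨fun z z' h => Subtype.ext (injOn_orbitPoint hF ha hw hs hw1 z.2 z'.2 h), fun q => ?_⟩
    obtain ⟨z, hz, h⟩ := surjOn_orbitPoint hF hw hs (mem_univ q)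
    exact ⟨⟨z, hz⟩, h⟩
  let τ : orbitLifts F ≃ₜ Torus2 :=
    Continuous.homeoOfEquivCompactToT2 (f := Equiv.ofBijective _ hbij) hcont
  have hτ : ∀ z, τ z = orbitPoint w z.1 := fun z => rfl
  let S := orbitLiftsShift F
  let Φ : Torus2 ≃ₜ Torus2 := τ.symm.trans (S.trans τ)
  have hΦ : ∀ z, Φ (τ z) = τ (S z) := fun z => by simp [Φ]
  have hΦn : ∀ (n : ℕ) z, Φ^[n] (τ z) = τ (S^[n] z) := fun n z =>
    ((show Function.Semiconj τ S Φ from fun z => (hΦ z).symm).iterate_right n z).symm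
  let P : Torus2 → Torus2 := fun q => collapse ((τ.symm q).1 0)
  have hP : ∀ z, P (τ z) = collapse (z.1 0) := fun z => by simp [P]
  let σ : orbitLifts F → orbitLifts F := fun z =>
    ⟨fun n => kleinInvolution (z.1 n), fun n => by
      rw [collapse_kleinInvolution, collapse_kleinInvolution, hsym, z.2 n]⟩
  have hσ : ∀ z, kleinInvolution (τ z) = τ (σ z) := fun z =>
    (orbitPoint_kleinInvolution w z.1).symm
  obtain ⟨z₀, hz₀, hz₀n⟩ := exists_orbitLift F (0, 0)
  have hz₀0 : collapse (z₀ 0) = (0, 0) := by rw [hz₀n, zpow_zero]; rfl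
  let v : Icc (0 : ℝ) 1 → Torus2 := fun t => (0, ((t.1 / 4 : ℝ) : AddCircle (1 : ℝ)))
  have hvabs : ∀ t : Icc (0 : ℝ) 1, |t.1 / 4| ≤ 1 / 4 := fun t => by
    obtain ⟨t, h0, h1⟩ := t
    rw [abs_of_nonneg (by simp only; linarith)]; simp only; linarith
  have hv : ∀ t, collapse (v t) = (0, 0) := fun t => collapse_coe (hvabs t)
  have hu : ∀ t n, collapse (Function.update z₀ 0 (v t) n) = collapse (z₀ n) := fun t n => by
    rcases eq_or_ne n 0 with rfl | hn
    · rw [Function.update_self, hv, hz₀0]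
    · rw [Function.update_of_ne hn]
  let ζ : Icc (0 : ℝ) 1 → orbitLifts F := fun t =>
    ⟨Function.update z₀ 0 (v t), fun n => by rw [hu, hu, hz₀ n]⟩
  have hζ : Continuous ζ := by
    refine Continuous.subtype_mk (continuous_const.update 0 ?_) _
    exact continuous_const.prodMk
      (continuous_coe_circle.comp (continuous_subtype_val.div_const 4))
  refine ⟨Φ, P, fun t => τ (ζ t), fun n => w (-n), ?_, ?_, ?_, ?_, ?_, ?_, ?_, ?_, ?_, ?_, ?_, ?_⟩
  · intro q
    obtain ⟨z, rfl⟩ := τ.surjective q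
    rw [hσ, hΦ, hΦ, hσ]; rfl
  · exact continuous_collapse.comp
      ((continuous_apply 0).comp (continuous_subtype_val.comp τ.symm.continuous))
  · intro q
    obtain ⟨z, hz, hzn⟩ := exists_orbitLift F q
    refine ⟨τ ⟨z, hz⟩, ?_⟩
    rw [hP, hzn, zpow_zero]; rfl
  · intro q
    obtain ⟨z, rfl⟩ := τ.surjective q
    rw [hΦ, hP, hP]
    exact z.2 0
  · intro q
    obtain ⟨z, rfl⟩ := τ.surjective q
    rw [hσ, hP, hP, ← collapse_kleinInvolution]
  · intro q
    obtain ⟨z, rfl⟩ := τ.surjective q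
    rw [hP, hτ]; rfl
  · intro q q' hq h
    obtain ⟨z, rfl⟩ := τ.surjective q
    obtain ⟨z', rfl⟩ := τ.surjective q'
    rw [hP, hP] at h
    refine congrArg τ (Subtype.ext (funext fun n => ?_))
    refine collapse_injOn ?_ ?_
    · rw [fst_orbitLift hF z.2 n]; exact hq n
    · have := collapse_orbitLift_add hF z'.2 z.2 (c := 0) (by rw [h]; simp) n
      rwa [Prod.mk_zero_zero, add_zero] at this
  · exact τ.continuous.comp hζ
  · intro t t' h
    have h1 : v t = v t' := by
      simpa [ζ] using congrFun (congrArg Subtype.val (τ.injective h)) 0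
    have h2 := congrArg triangleWave (congrArg Prod.snd h1)
    simp only [v, triangleWave_coe (hvabs _)] at h2
    exact Subtype.ext (by linarith)
  · intro t
    have h1 : (orbitPoint w (ζ t).1).1 = (Function.update z₀ 0 (v t) 0).1 := rfl
    simp only [hτ, h1, Function.update_self, v]
  · have h1 : Tendsto (fun n : ℕ => (-(n : ℤ))) atTop cofinite := by
      rw [← Nat.cofinite_eq_atTop]
      exact (neg_injective.comp Nat.cast_injective).tendsto_cofinite
    exact hs.tendsto_cofinite_zero.comp h1
  · intro n t t'
    rw [hΦn, hΦn, hτ, hτ]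
    refine dist_orbitPoint_le hw hs (fun k hk => ?_) (fun k => ?_)
    · rw [orbitLiftsShift_iterate_apply, orbitLiftsShift_iterate_apply]
      have : k + n ≠ 0 := fun h => hk (by omega)
      simp only [ζ, Function.update_of_ne this]
    · rw [orbitLiftsShift_iterate_apply, orbitLiftsShift_iterate_apply]
      exact (hu t _).trans (hu t' _).symm

theorem nsmul_ne_zero_of_isMinimalMap {F : Torus2 → Torus2} {a : AddCircle (1 : ℝ)}
    {r : AddCircle (1 : ℝ) → AddCircle (1 : ℝ)} (hF : ∀ q, F q = (q.1 + a, q.2 + r q.1))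
    (hmin : IsMinimalMap F) {n : ℕ} (hn : n ≠ 0) : n • a ≠ 0 := by
  intro h
  have hfst : ∀ k, (F^[k] (0, 0)).1 = k • a := fun k => by
    induction k with
    | zero => simp
    | succ k ih => rw [Function.iterate_succ_apply', hF, ih, succ_nsmul]
  have hcl : IsClosed {q : Torus2 | n • q.1 = 0} := isClosed_eq (by fun_prop) continuous_const
  have hall := closure_minimal (s := range fun k : ℕ => F^[k + 1] (0, 0))
    (by rintro _ ⟨k, rfl⟩; change n • (F^[k + 1] (0, 0)).1 = 0
        rw [hfst, smul_comm, h, smul_zero]) hcl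
  rw [(hmin.2 (0, 0)).closure_eq] at hall
  have hpos : (n : ℝ) ≠ 0 := Nat.cast_ne_zero.2 hn
  have h1 : n • ((1 / 2 / n : ℝ) : AddCircle (1 : ℝ)) = 0 :=
    hall (mem_univ ((((1 / 2 / n : ℝ) : AddCircle (1 : ℝ)), 0) : Torus2))
  rw [← AddCircle.coe_nsmul, nsmul_eq_mul, mul_div_cancel₀ _ hpos] at h1
  exact circle_half_ne_zero h1

/-- An extension of a minimal map whose injectivity points are dense is minimal. -/
theorem IsMinimalMap.of_factor {X Y : Type*} [TopologicalSpace X] [CompactSpace X]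
    [TopologicalSpace Y] [T2Space Y] {f : X → X} {g : Y → Y} {P : X → Y} (hf : Continuous f)
    (hg : IsMinimalMap g) (hP : Continuous P) (h : ∀ x, P (f x) = g (P x))
    (hd : Dense {x | ∀ x', P x = P x' → x = x'}) : IsMinimalMap f := by
  refine ⟨hf, fun x => ?_⟩
  set M := closure (range fun n : ℕ => f^[n + 1] x)
  have hM : P '' M = univ := by
    refine (((isClosed_closure (s := _)).isCompact.image hP).isClosed.closure_eq).symm.trans ?_
    refine ((hg.2 (P x)).mono ?_).closure_eq
    rintro _ ⟨n, rfl⟩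
    refine ⟨f^[n + 1] x, subset_closure ⟨n, rfl⟩, ?_⟩
    exact (show Function.Semiconj P f g from h).iterate_right (n + 1) x
  refine dense_closure.1 (hd.mono fun y hy => ?_)
  obtain ⟨y', hy', he⟩ := hM.symm ▸ mem_univ (P y)
  rwa [hy y' he.symm]

theorem klein_eqvGen_iff {a b : Torus2} :
    Relation.EqvGen kleinRel a b ↔ b = a ∨ b = kleinInvolution a := by
  constructor
  · intro h
    induction h with
    | rel a b h => exact Or.inr h
    | refl a => exact Or.inl rfl
    | symm a b _ ih =>
      rcases ih with rfl | rfl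
      · exact Or.inl rfl
      · exact Or.inr (kleinInvolution_involutive a).symm
    | trans a b c _ _ ih1 ih2 =>
      rcases ih1 with rfl | rfl
      · exact ih2
      · rcases ih2 with rfl | rfl
        · exact Or.inr rfl
        · exact Or.inl (kleinInvolution_involutive a)
  · rintro (rfl | rfl)
    · exact .refl _
    · exact .rel _ _ rfl

section Quotient

variable {K : Type*} [TopologicalSpace K] {p : Torus2 → K}

theorem exists_descend (hquot : IsQuotientMap p)
    (hp : ∀ a b, p a = p b ↔ b = a ∨ b = kleinInvolution a) {f : Torus2 → Torus2}
    (hf : Continuous f) (hsym : ∀ q, f (kleinInvolution q) = kleinInvolution (f q)) :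
    ∃ g : K → K, Continuous g ∧ ∀ q, g (p q) = p (f q) := by
  have hsec := Function.surjInv_eq hquot.surjective
  have key : ∀ q, p (f (Function.surjInv hquot.surjective (p q))) = p (f q) := fun q => by
    rcases (hp _ _).1 (hsec (p q)) with h | h
    · rw [← h]
    · rw [(hp _ _).2 (Or.inr rfl), ← hsym, ← h]
  refine ⟨fun k => p (f (Function.surjInv hquot.surjective k)), ?_, key⟩
  rw [hquot.continuous_iff]
  exact (hquot.continuous.comp hf).congr fun q => (key q).symm

theorem exists_descend_homeomorph (hquot : IsQuotientMap p)
    (hp : ∀ a b, p a = p b ↔ b = a ∨ b = kleinInvolution a) (Φ : Torus2 ≃ₜ Torus2)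
    (hsym : ∀ q, Φ (kleinInvolution q) = kleinInvolution (Φ q)) :
    ∃ H : K ≃ₜ K, ∀ q, H (p q) = p (Φ q) := by
  obtain ⟨g, hg, hgp⟩ := exists_descend hquot hp Φ.continuous hsym
  obtain ⟨g', hg', hgp'⟩ := exists_descend hquot hp Φ.symm.continuous fun q => by
    rw [Φ.symm_apply_eq, hsym, Φ.apply_symm_apply]
  refine ⟨⟨⟨g, g', fun k => ?_, fun k => ?_⟩, hg, hg'⟩, hgp⟩
  · obtain ⟨q, rfl⟩ := hquot.surjective k
    rw [hgp, hgp', Φ.symm_apply_apply]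
  · obtain ⟨q, rfl⟩ := hquot.surjective k
    rw [hgp', hgp, Φ.apply_symm_apply]

end Quotient

/-- For a minimal Parry-type skew product of the torus inducing a minimal
homeomorphism `G` of the Klein bottle `K`, there is a minimal homeomorphism `H` of
`K` which is an almost 1-1 extension of `G` and an arc `D` with
`diam H^n(D) → 0`. -/
theorem stmt9 {K : Type*} [MetricSpace K] (p : Torus2 → K)
    (hquot : IsQuotientMap p)
    (hfib : ∀ a b : Torus2, p a = p b ↔ Relation.EqvGen kleinRel a b)
    (α : ℝ) (r : AddCircle (1 : ℝ) → AddCircle (1 : ℝ))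
    (ρ : ℝ → ℝ) (hρ : Differentiable ℝ ρ)
    (hdeg : ∀ x : ℝ, ∃ n : ℤ, ρ (x + 1) - ρ x = (n : ℝ))
    (hr : ∀ x : ℝ, r (x : AddCircle (1 : ℝ)) = ((ρ x : ℝ) : AddCircle (1 : ℝ)))
    (hsym : ∀ x : AddCircle (1 : ℝ),
      r (x + (((1 : ℝ) / 2 : ℝ) : AddCircle (1 : ℝ))) = (((1 : ℝ) : AddCircle (1 : ℝ))) - r x)
    (F : Torus2 ≃ₜ Torus2)
    (hF : ∀ q : Torus2, F q = (q.1 + ((α : ℝ) : AddCircle (1 : ℝ)), q.2 + r q.1))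
    (hFmin : IsMinimalMap (F : Torus2 → Torus2))
    (G : K ≃ₜ K) (hG : ∀ a : Torus2, G (p a) = p (F a)) :
    ∃ H : K ≃ₜ K, IsMinimalMap (H : K → K) ∧
      ∃ π : K → K, IsFactorMap π (H : K → K) (G : K → K) ∧ IsAlmostOneOne π ∧
        ∃ D : Set K, IsArc D ∧
          Filter.Tendsto (fun n : ℕ => Metric.diam ((H : K → K)^[n] '' D))
            Filter.atTop (nhds 0) := by
  have hp : ∀ a b, p a = p b ↔ b = a ∨ b = kleinInvolution a := fun a b =>
    (hfib a b).trans klein_eqvGen_iff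
  have ha : ∀ n : ℤ, n ≠ 0 → n • ((2 : ℕ) • (α : AddCircle (1 : ℝ))) ≠ 0 := by
    intro n hn h
    have h1 : (n.natAbs * 2) • (α : AddCircle (1 : ℝ)) = 0 := by
      rw [mul_nsmul']
      rcases Int.natAbs_eq n with h2 | h2 <;> rw [h2] at h
      · simpa using h
      · simpa using h
    exact nsmul_ne_zero_of_isMinimalMap hF hFmin (by omega) h1
  have hFsym : ∀ q, F (kleinInvolution q) = kleinInvolution (F q) := by
    intro q
    rw [hF, hF]
    simp only [kleinInvolution, hsym, circle_coe_one, Prod.mk.injEq]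
    constructor <;> abel
  obtain ⟨Φ, P, γ, ε, hΦσ, hP, hPs, hPΦ, hPσ, hPfst, hPinj, hγ, hγinj, hγfst, hε, hdist⟩ :=
    exists_torus_extension hF ha hFsym
  obtain ⟨H, hH⟩ := exists_descend_homeomorph hquot hp Φ hΦσ
  obtain ⟨π, hπ, hπp⟩ := exists_descend hquot hp hP hPσ
  have hHn : ∀ (n : ℕ) q, H^[n] (p q) = p (Φ^[n] q) := fun n q =>
    ((show Function.Semiconj p Φ H from fun q => (hH q).symm).iterate_right n q).symm
  have hΦmin : IsMinimalMap (Φ : Torus2 → Torus2) :=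
    IsMinimalMap.of_factor Φ.continuous hFmin hP hPΦ
      ((dense_regular (α : AddCircle (1 : ℝ))).mono fun q hq q' h => hPinj q q' hq h)
  refine ⟨H, ⟨H.continuous, fun k => ?_⟩, π, ⟨hπ, fun k => ?_, ?_⟩, ?_, ?_⟩
  · obtain ⟨q, rfl⟩ := hquot.surjective k
    refine (hquot.surjective.denseRange.dense_image hquot.continuous (hΦmin.2 q)).mono ?_
    rintro _ ⟨_, ⟨n, rfl⟩, rfl⟩
    exact ⟨n, hHn _ _⟩
  · obtain ⟨q, rfl⟩ := hquot.surjective k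
    obtain ⟨q', rfl⟩ := hPs q
    exact ⟨p q', hπp q'⟩
  · funext k
    obtain ⟨q, rfl⟩ := hquot.surjective k
    simp only [Function.comp_apply, hH, hπp, hG, hPΦ]
  · refine (hquot.surjective.denseRange.dense_image hquot.continuous
      (dense_regular (α : AddCircle (1 : ℝ)))).mono ?_
    rintro _ ⟨q, hq, rfl⟩
    obtain ⟨b, rfl⟩ := hPs q
    have hb : ∀ n : ℤ, (2 : ℕ) • (b.1 + n • (α : AddCircle (1 : ℝ))) ≠ 0 := by
      rw [← hPfst b]; exact hq
    refine ⟨p b, hπp b, fun k hk => ?_⟩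
    obtain ⟨c, rfl⟩ := hquot.surjective k
    rw [hπp] at hk
    rcases (hp _ _).1 hk with h | h
    · rw [hPinj b c hb h]
    · rw [← hPσ] at h
      exact (hp _ _).2 (Or.inr (hPinj b _ hb h))
  · have hcont : Continuous fun t => p (γ t) := hquot.continuous.comp hγ
    have hinj : Function.Injective fun t => p (γ t) := by
      intro t t' h
      rcases (hp _ _).1 h with h | h
      · exact (hγinj h).symm
      · have h1 := congrArg Prod.fst h
        simp only [kleinInvolution, hγfst, zero_add] at h1
        exact absurd h1.symm circle_half_ne_zero
    refine ⟨range fun t => p (γ t),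
      ⟨(hcont.isClosedEmbedding hinj).isEmbedding.toHomeomorph.symm⟩, ?_⟩
    have huc := CompactSpace.uniformContinuous_of_continuous hquot.continuous
    rw [Metric.tendsto_atTop]
    intro e he
    obtain ⟨δ, hδ, hpδ⟩ := Metric.uniformContinuous_iff.1 huc (e / 2) (half_pos he)
    obtain ⟨N, hN⟩ := eventually_atTop.1 (hε.eventually (gt_mem_nhds hδ))
    refine ⟨N, fun n hn => ?_⟩
    rw [Real.dist_0_eq_abs, abs_of_nonneg Metric.diam_nonneg]
    refine (Metric.diam_le_of_forall_dist_le (half_pos he).le ?_).trans_lt (half_lt_self he)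
    rintro _ ⟨_, ⟨t, rfl⟩, rfl⟩ _ ⟨_, ⟨t', rfl⟩, rfl⟩
    simp only [hHn]
    exact (hpδ ((hdist n t t').trans_lt (hN n hn))).le
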